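/- arXiv:1511.02162 — 2 statements merged into one kernel-verified Lean document; each statement's English description precedes it below -/
import Mathlib

section
/- One has sup_{0<t<1} ∫_{t<|y|<1} K_{B(0,t)}(0,y) (1−|y|)^{α/2−1} dy < ∞; that is, the function t ↦ H_{B(0,t)}^α(δ^{α/2−1}·1_B)(0) is bounded on (0,1). -/
open MeasureTheory Real Filter Topology Metric Set

noncomputable section

abbrev EN (N : ℕ) := EuclideanSpace ℝ (Fin N)

/-- The normalizing constant `c_{N,α}` of the fractional Laplacian. -/
def fracLapCoeff (N : ℕ) (α : ℝ) : ℝ :=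
  2 ^ α * Real.pi ^ (-(N : ℝ) / 2) * Real.Gamma (((N : ℝ) + α) / 2) / |Real.Gamma (-α / 2)|

/-- `HasFracLap N α u x L` means the principal-value limit defining `Δ^{α/2} u (x)` exists
and equals `L`. -/
def HasFracLap (N : ℕ) (α : ℝ) (u : EN N → ℝ) (x : EN N) (L : ℝ) : Prop :=
  Tendsto (fun ε : ℝ =>
      fracLapCoeff N α * ∫ y in {y : EN N | ε < dist y x}, (u y - u x) / dist y x ^ ((N : ℝ) + α))
    (𝓝[>] (0 : ℝ)) (𝓝 L)

/-- The value of the fractional Laplacian at `x` (junk value `0` where the limit fails). -/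
def fracLap (N : ℕ) (α : ℝ) (u : EN N → ℝ) (x : EN N) : ℝ :=
  haveI := Classical.propDecidable (∃ L, HasFracLap N α u x L)
  if h : ∃ L, HasFracLap N α u x L then h.choose else 0

/-- The weighted space `𝓛_α`. -/
def memLalpha (N : ℕ) (α : ℝ) (u : EN N → ℝ) : Prop :=
  Integrable (fun y : EN N => u y * (1 + ‖y‖) ^ (-((N : ℝ) + α)))

/-- `δ(x) = 1 - |x|` on the unit ball, `0` outside. -/
def delta1 {N : ℕ} (x : EN N) : ℝ := if ‖x‖ < 1 then 1 - ‖x‖ else 0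

/-- The constant `κ_{N,α}`. -/
def greenCoeff (N : ℕ) (α : ℝ) : ℝ :=
  Real.Gamma ((N : ℝ) / 2) / (2 ^ α * Real.pi ^ ((N : ℝ) / 2) * Real.Gamma (α / 2) ^ 2)

/-- The Green function of the unit ball. -/
def greenB (N : ℕ) (α : ℝ) (x y : EN N) : ℝ :=
  if ‖x‖ < 1 ∧ ‖y‖ < 1 then
    greenCoeff N α * ‖x - y‖ ^ (α - (N : ℝ)) *
      ∫ s in (0:ℝ)..((1 - ‖x‖ ^ 2) * (1 - ‖y‖ ^ 2) / ‖x - y‖ ^ 2),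
        s ^ (α / 2 - 1) * (1 + s) ^ (-(N : ℝ) / 2)
  else 0

/-- The Green function of the ball `B(a,r)`, by scaling. -/
def greenBall (N : ℕ) (α : ℝ) (a : EN N) (r : ℝ) (x y : EN N) : ℝ :=
  r ^ (α - (N : ℝ)) * greenB N α (r⁻¹ • (x - a)) (r⁻¹ • (y - a))

/-- The constant `c_α^N` of the Poisson kernel. -/
def poissonCoeff (N : ℕ) (α : ℝ) : ℝ :=
  Real.pi ^ (-1 - (N : ℝ) / 2) * Real.Gamma ((N : ℝ) / 2) * Real.sin (Real.pi * α / 2)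

/-- The Poisson kernel of the ball `B(a,r)`. -/
def poissonBall (N : ℕ) (α : ℝ) (a : EN N) (r : ℝ) (x y : EN N) : ℝ :=
  poissonCoeff N α * ((r ^ 2 - ‖x - a‖ ^ 2) / (‖y - a‖ ^ 2 - r ^ 2)) ^ (α / 2) *
    ‖x - y‖ ^ (-(N : ℝ))

/-- The harmonic-measure operator `H^α_{B(a,r)} f`. -/
def Hball (N : ℕ) (α : ℝ) (a : EN N) (r : ℝ) (f : EN N → ℝ) (x : EN N) : ℝ :=
  ∫ y in {y : EN N | r < ‖y - a‖}, poissonBall N α a r x y * f y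

/-- Solution (in the distributional sense) of `Δ^{α/2} u = u^γ` in the open set `U`. -/
def IsSolution (N : ℕ) (α γ : ℝ) (U : Set (EN N)) (u : EN N → ℝ) : Prop :=
  (∀ x, 0 ≤ u x) ∧ ContinuousOn u U ∧ memLalpha N α u ∧
    ∀ φ : EN N → ℝ, ContDiff ℝ (⊤ : ℕ∞) φ → HasCompactSupport φ → tsupport φ ⊆ U →
      (∀ x, 0 ≤ φ x) →
        ∫ x, u x * fracLap N α φ x = ∫ x, u x ^ γ * φ x

/-- The surface measure `σ` on the unit sphere. -/
def sphereMeasure (N : ℕ) : Measure (Metric.sphere (0 : EN N) 1) :=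
  (volume : Measure (EN N)).toSphere

/-- The Martin integral `M_B^α g`. -/
def martinB (N : ℕ) (α : ℝ) (g : Metric.sphere (0 : EN N) 1 → ℝ) (x : EN N) : ℝ :=
  if ‖x‖ < 1 then
    ∫ y, (1 - ‖x‖ ^ 2) ^ (α / 2) * ‖x - (y : EN N)‖ ^ (-(N : ℝ)) * g y ∂(sphereMeasure N)
  else 0

/-- Solution of the moderate blow-up problem `(P_g)`. -/
def IsSolutionPg (N : ℕ) (α γ : ℝ) (g : Metric.sphere (0 : EN N) 1 → ℝ) (u : EN N → ℝ) : Prop :=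
  (∀ x, 0 ≤ u x) ∧ memLalpha N α u ∧ (∀ x : EN N, ¬ ‖x‖ < 1 → u x = 0) ∧
    IsSolution N α γ (Metric.ball (0 : EN N) 1) u ∧
    ∀ z : Metric.sphere (0 : EN N) 1,
      Tendsto (fun x => delta1 x ^ (1 - α / 2) * u x)
        (𝓝[Metric.ball (0 : EN N) 1] (z : EN N)) (𝓝 (g z))

/-- Solution of the blow-up problem `(P_∞)`. -/
def IsSolutionPinf (N : ℕ) (α γ : ℝ) (u : EN N → ℝ) : Prop :=
  (∀ x, 0 ≤ u x) ∧ memLalpha N α u ∧ (∀ x : EN N, ¬ ‖x‖ < 1 → u x = 0) ∧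
    IsSolution N α γ (Metric.ball (0 : EN N) 1) u ∧
    ∀ z : Metric.sphere (0 : EN N) 1,
      Tendsto (fun x => delta1 x ^ (1 - α / 2) * u x)
        (𝓝[Metric.ball (0 : EN N) 1] (z : EN N)) atTop


lemma lintegral_polar (N : ℕ) (hN : 3 ≤ N) (f : ℝ → ENNReal) (hf : Measurable f) :
    ∫⁻ x : EN N, f ‖x‖ = (volume : Measure (EN N)).toSphere univ *
      ∫⁻ r in Ioi (0 : ℝ), ENNReal.ofReal (r ^ (N - 1)) * f r := by
  have : Nonempty (Fin N) := ⟨⟨0, by omega⟩⟩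
  have : Nontrivial (EN N) := inferInstance
  have hd : Module.finrank ℝ (EN N) = N := by simp
  calc
    ∫⁻ x : EN N, f ‖x‖
      = ∫⁻ x : ({(0)}ᶜ : Set (EN N)), f (‖x.1‖) ∂((volume : Measure (EN N)).comap (↑)) := by
        rw [lintegral_subtype_comap (measurableSet_singleton _).compl (fun x : EN N ↦ f (‖x‖)),
          restrict_compl_singleton]
    _ = ∫⁻ x, f x.2 ∂((volume : Measure (EN N)).toSphere.prod (.volumeIoiPow (N - 1))) := by
        have h := (volume : Measure (EN N)).measurePreserving_homeomorphUnitSphereProd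
        rw [hd] at h
        simpa using h.lintegral_comp_emb
          (Homeomorph.measurableEmbedding _) (f ∘ Subtype.val ∘ Prod.snd)
    _ = (volume : Measure (EN N)).toSphere univ *
        ∫⁻ x : Ioi (0 : ℝ), f x ∂.volumeIoiPow (N - 1) := by
        rw [lintegral_prod _ (by fun_prop)]
        simp [mul_comm]
    _ = _ := by
        congr 1
        rw [Measure.volumeIoiPow, lintegral_withDensity_eq_lintegral_mul _ (by fun_prop)
          (by fun_prop)]
        exact lintegral_subtype_comap measurableSet_Ioi
          (fun r : ℝ => ENNReal.ofReal (r ^ (N - 1)) * f r)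

/-- The one-dimensional integral, bounded by the Beta integral. -/
lemma one_dim (β : ℝ) (h0 : 0 < β) (h1 : β < 1) (t : ℝ) (ht0 : 0 < t) (ht1 : t < 1) :
    ∫⁻ r in Ioo t 1, ENNReal.ofReal (t ^ β * (r - t) ^ (-β) * r⁻¹ * (1 - r) ^ (β - 1)) ≤
      ENNReal.ofReal (ProbabilityTheory.beta (1 - β) β) := by
  set φ : ℝ → ℝ := fun u => t / (1 - (1 - t) * u) with hφ
  have hD : ∀ u ∈ Ioo (0 : ℝ) 1, 0 < 1 - (1 - t) * u := by
    intro u hu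
    nlinarith [hu.1, hu.2]
  have hsub : Ioo t 1 ⊆ φ '' Ioo 0 1 := by
    intro r hr
    have hr0 : 0 < r := ht0.trans hr.1
    have h1t : 0 < 1 - t := by linarith
    refine ⟨(r - t) / (r * (1 - t)), ⟨?_, ?_⟩, ?_⟩
    · have := sub_pos.2 hr.1
      positivity
    · rw [div_lt_one (by positivity)]
      nlinarith [hr.2]
    · simp only [hφ]
      have : 1 - (1 - t) * ((r - t) / (r * (1 - t))) = t / r := by
        field_simp
        ring
      rw [this]
      field_simp
  have hder : ∀ u ∈ Ioo (0 : ℝ) 1, HasDerivWithinAt φ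
      (t * (1 - t) / (1 - (1 - t) * u) ^ 2) (Ioo 0 1) u := by
    intro u hu
    have h := ((((hasDerivAt_id u).const_mul (1 - t)).const_sub 1).inv (hD u hu).ne').const_mul t
    refine HasDerivAt.hasDerivWithinAt ?_
    have h2 : φ = fun u => t * (1 - (1 - t) * u)⁻¹ := by
      ext u; simp [hφ, div_eq_mul_inv]
    rw [h2]
    refine HasDerivAt.congr_deriv (f := fun u => t * (1 - (1 - t) * u)⁻¹) h ?_
    simp only [id, mul_one, neg_neg]
    ring
  have hinj : InjOn φ (Ioo 0 1) := by
    intro u hu v hv huv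
    simp only [hφ] at huv
    rw [div_eq_div_iff (hD u hu).ne' (hD v hv).ne'] at huv
    have h1t : 0 < 1 - t := by linarith
    have : t * (1 - t) * (u - v) = 0 := by linear_combination huv
    have h3 : t * (1 - t) ≠ 0 := by positivity
    have := (mul_eq_zero.1 this).resolve_left h3
    linarith
  refine (lintegral_mono_set hsub).trans ?_
  rw [lintegral_image_eq_lintegral_abs_deriv_mul measurableSet_Ioo hder hinj]
  have hb : 0 < ProbabilityTheory.beta (1 - β) β :=
    ProbabilityTheory.beta_pos (by linarith) h0
  have key : ∀ u ∈ Ioo (0 : ℝ) 1,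
      ENNReal.ofReal |t * (1 - t) / (1 - (1 - t) * u) ^ 2| *
        ENNReal.ofReal (t ^ β * (φ u - t) ^ (-β) * (φ u)⁻¹ * (1 - φ u) ^ (β - 1)) =
      ENNReal.ofReal (ProbabilityTheory.beta (1 - β) β) *
        ENNReal.ofReal (1 / ProbabilityTheory.beta (1 - β) β * u ^ ((1 - β) - 1) *
          (1 - u) ^ (β - 1)) := by
    intro u hu
    have hDu := hD u hu
    have h1t : 0 < 1 - t := by linarith
    have hu0 := hu.1
    have h1u : 0 < 1 - u := by linarith [hu.2]
    rw [← ENNReal.ofReal_mul (abs_nonneg _), ← ENNReal.ofReal_mul hb.le]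
    congr 1
    have e1 : φ u - t = t * (1 - t) * u / (1 - (1 - t) * u) := by
      simp only [hφ]
      field_simp
      ring
    have e2 : 1 - φ u = (1 - t) * (1 - u) / (1 - (1 - t) * u) := by
      simp only [hφ]
      field_simp
      ring
    rw [e1, e2, abs_of_nonneg (by positivity)]
    simp only [hφ]
    set D := 1 - (1 - t) * u with hDdef
    rw [show (1 - β - 1 : ℝ) = -β by ring]
    rw [div_rpow (by positivity) hDu.le, div_rpow (by positivity) hDu.le,
      mul_rpow (by positivity) hu0.le, mul_rpow ht0.le h1t.le, mul_rpow h1t.le h1u.le,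
      rpow_sub_one hDu.ne', rpow_sub_one h1t.ne', rpow_neg hDu.le, rpow_neg ht0.le, rpow_neg h1t.le]
    have p1 : 0 < D ^ β := by positivity
    have p2 : 0 < t ^ β := by positivity
    have p3 : 0 < (1 - t) ^ β := by positivity
    field_simp
  rw [setLIntegral_congr_fun measurableSet_Ioo key, lintegral_const_mul' _ _ ENNReal.ofReal_ne_top,
    ← ProbabilityTheory.lintegral_betaPDF,
    ProbabilityTheory.lintegral_betaPDF_eq_one (by linarith) h0, mul_one]

/-- Pointwise bound of the radial integrand. -/
lemma radial_bound (N : ℕ) (hN : 3 ≤ N) (β : ℝ) (h0 : 0 < β) (t r : ℝ)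
    (ht0 : 0 < t) (hr : t < r) (hr1 : r < 1) :
    r ^ (N - 1) * ((t ^ 2 / (r ^ 2 - t ^ 2)) ^ β * r ^ (-(N : ℝ)) * (1 - r) ^ (β - 1)) ≤
      t ^ β * (r - t) ^ (-β) * r⁻¹ * (1 - r) ^ (β - 1) := by
  have hr0 : 0 < r := ht0.trans hr
  have hrt : 0 < r - t := sub_pos.2 hr
  have h1r : 0 < 1 - r := sub_pos.2 hr1
  have e1 : r ^ (N - 1) * r ^ (-(N : ℝ)) = r⁻¹ := by
    rw [rpow_neg hr0.le, rpow_natCast]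
    obtain ⟨m, rfl⟩ : ∃ m, N = m + 1 := ⟨N - 1, by omega⟩
    simp only [Nat.add_sub_cancel, pow_succ]
    field_simp
  have e2 : (t ^ 2 / (r ^ 2 - t ^ 2)) ^ β ≤ t ^ β * (r - t) ^ (-β) := by
    rw [rpow_neg hrt.le, ← div_eq_mul_inv, ← div_rpow ht0.le hrt.le]
    have : 0 < r ^ 2 - t ^ 2 := by nlinarith
    refine rpow_le_rpow (by positivity) ?_ h0.le
    rw [div_le_div_iff₀ this hrt]
    nlinarith [mul_pos (mul_pos ht0 hrt) hr0]
  calc _ = (t ^ 2 / (r ^ 2 - t ^ 2)) ^ β * (r⁻¹ * (1 - r) ^ (β - 1)) := by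
        rw [← e1]; ring
    _ ≤ t ^ β * (r - t) ^ (-β) * (r⁻¹ * (1 - r) ^ (β - 1)) := by gcongr
    _ = _ := by ring

/-- the function `t ↦ H_{B_t}^α (δ^{α/2-1} 1_B)(0)` is bounded on `(0,1)`. -/
theorem statement_18 (N : ℕ) (hN : 3 ≤ N) (α : ℝ) (hα0 : 0 < α) (hα2 : α < 2) :
    ∃ M : ℝ, ∀ t : ℝ, 0 < t → t < 1 →
      (∫⁻ y in {y : EN N | t < ‖y‖},
        ENNReal.ofReal (poissonBall N α 0 t 0 y * delta1 y ^ (α / 2 - 1))) ≤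
        ENNReal.ofReal M := by
  set S := (volume : Measure (EN N)).toSphere univ with hS
  have hSfin : S ≠ ⊤ := measure_ne_top _ _
  set c := |poissonCoeff N α| with hc
  have hc0 : 0 ≤ c := abs_nonneg _
  set β := α / 2 with hβ
  have hβ0 : 0 < β := by positivity
  have hβ1 : β < 1 := by rw [hβ]; linarith
  refine ⟨(S * (ENNReal.ofReal c * ENNReal.ofReal (ProbabilityTheory.beta (1 - β) β))).toReal, ?_⟩
  intro t ht0 ht1
  rw [ENNReal.ofReal_toReal (ENNReal.mul_ne_top hSfin
    (ENNReal.mul_ne_top ENNReal.ofReal_ne_top ENNReal.ofReal_ne_top))]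
  set F : ℝ → ENNReal := (Ioo t 1).indicator (fun r => ENNReal.ofReal
    (c * ((t ^ 2 / (r ^ 2 - t ^ 2)) ^ β * r ^ (-(N : ℝ)) * (1 - r) ^ (β - 1)))) with hF
  have hFm : Measurable F := by
    refine Measurable.indicator ?_ measurableSet_Ioo
    fun_prop
  have hms : MeasurableSet {y : EN N | t < ‖y‖} := measurableSet_lt measurable_const measurable_norm
  calc _ ≤ ∫⁻ y in {y : EN N | t < ‖y‖}, F ‖y‖ := by
        refine setLIntegral_mono' hms ?_
        intro y hy
        have hy : t < ‖y‖ := hy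
        by_cases hy1 : ‖y‖ < 1
        · rw [hF, indicator_of_mem (show ‖y‖ ∈ Ioo t 1 from ⟨hy, hy1⟩)]
          apply ENNReal.ofReal_le_ofReal
          have h1 : 0 < ‖y‖ ^ 2 - t ^ 2 := by nlinarith
          have h2 : 0 < 1 - ‖y‖ := by linarith
          simp only [poissonBall, delta1, hy1, if_true, sub_zero, zero_sub, norm_neg, norm_zero,
            ← hβ]
          rw [show t ^ 2 - (0 : ℝ) ^ 2 = t ^ 2 by ring, mul_assoc, mul_assoc, mul_assoc]
          exact mul_le_mul_of_nonneg_right (le_abs_self _) (by positivity)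
        · have : delta1 y ^ (β - 1) = 0 := by
            simp only [delta1, hy1, if_false]
            exact zero_rpow (by linarith)
          rw [this]
          simp
    _ ≤ ∫⁻ y : EN N, F ‖y‖ := setLIntegral_le_lintegral _ _
    _ = S * ∫⁻ r in Ioi (0 : ℝ), ENNReal.ofReal (r ^ (N - 1)) * F r := lintegral_polar N hN F hFm
    _ ≤ _ := by
        gcongr
        calc _ ≤ ∫⁻ r in Ioi (0 : ℝ), (Ioo t 1).indicator (fun r => ENNReal.ofReal c *
              ENNReal.ofReal (t ^ β * (r - t) ^ (-β) * r⁻¹ * (1 - r) ^ (β - 1))) r := by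
              refine setLIntegral_mono' measurableSet_Ioi ?_
              intro r hr0
              by_cases hr : r ∈ Ioo t 1
              · have hr0' : (0 : ℝ) < r := hr0
                rw [hF, indicator_of_mem hr, indicator_of_mem hr,
                  ← ENNReal.ofReal_mul (by positivity), ← ENNReal.ofReal_mul hc0]
                apply ENNReal.ofReal_le_ofReal
                rw [mul_left_comm]
                exact mul_le_mul_of_nonneg_left
                  (radial_bound N hN β hβ0 t r ht0 hr.1 hr.2) hc0
              · rw [hF, indicator_of_notMem hr, indicator_of_notMem hr, mul_zero]
          _ ≤ _ := setLIntegral_le_lintegral _ _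
          _ = ENNReal.ofReal c * ∫⁻ r in Ioo t 1,
              ENNReal.ofReal (t ^ β * (r - t) ^ (-β) * r⁻¹ * (1 - r) ^ (β - 1)) := by
              rw [lintegral_indicator measurableSet_Ioo,
                lintegral_const_mul' _ _ ENNReal.ofReal_ne_top]
          _ ≤ _ := by
              gcongr
              exact one_dim β hβ0 hβ1 t ht0 ht1

end
end

section
/- Let γ ≥ (2+α)/(2−α), let z ∈ ∂B and let r > 0. Then ∫_{B ∩ B(z,r)} G_B^α(0,y) δ(y)^{γ(α/2−1)} dy = ∞. -/
open MeasureTheory Real Filter Topology Metric Set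

noncomputable section

lemma green_inner_aux (N : ℕ) (α : ℝ) (hα0 : 0 < α) (d T : ℝ) (hd0 : 0 < d) (hd1 : d ≤ 1)
    (hdT : d ≤ T) :
    (2:ℝ) ^ (-(N : ℝ) / 2) * (d ^ (α / 2) / (α / 2)) ≤
      ∫ s in (0:ℝ)..T, s ^ (α / 2 - 1) * (1 + s) ^ (-(N : ℝ) / 2) := by
  have hI : ∀ c : ℝ, 0 ≤ c → IntervalIntegrable
      (fun s : ℝ => s ^ (α / 2 - 1) * (1 + s) ^ (-(N : ℝ) / 2)) volume 0 c := by
    intro c hc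
    refine (intervalIntegral.intervalIntegrable_rpow' (by linarith)).mul_continuousOn ?_
    refine ContinuousOn.rpow_const (by fun_prop) ?_
    intro x hx
    rw [uIcc_of_le hc] at hx
    left
    linarith [hx.1]
  have h1 : ∫ s in (0:ℝ)..d, s ^ (α / 2 - 1) * (1 + s) ^ (-(N : ℝ) / 2) ≤
      ∫ s in (0:ℝ)..T, s ^ (α / 2 - 1) * (1 + s) ^ (-(N : ℝ) / 2) := by
    refine intervalIntegral.integral_mono_interval le_rfl hd0.le hdT ?_ (hI T (hd0.le.trans hdT))
    filter_upwards [ae_restrict_mem measurableSet_Ioc] with s hs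
    have : 0 < s := hs.1
    simp only [Pi.zero_apply]
    positivity
  refine le_trans ?_ h1
  have h2 : ∫ s in (0:ℝ)..d, (2:ℝ) ^ (-(N : ℝ) / 2) * s ^ (α / 2 - 1) =
      (2:ℝ) ^ (-(N : ℝ) / 2) * (d ^ (α / 2) / (α / 2)) := by
    rw [intervalIntegral.integral_const_mul, integral_rpow (Or.inl (by linarith))]
    rw [sub_add_cancel, Real.zero_rpow (by positivity), sub_zero]
  rw [← h2]
  refine intervalIntegral.integral_mono_on_of_le_Ioo hd0.le ?_ (hI d hd0.le) ?_
  · exact (intervalIntegral.intervalIntegrable_rpow' (by linarith)).const_mul _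
  · intro s hs
    rw [mul_comm]
    have : 0 < s := hs.1
    refine mul_le_mul_of_nonneg_left ?_ (by positivity)
    refine Real.rpow_le_rpow_of_nonpos (by linarith) (by linarith [hs.2]) ?_
    have : (0:ℝ) ≤ N := Nat.cast_nonneg N
    linarith

lemma green_lower_aux (N : ℕ) (hN : 3 ≤ N) (α : ℝ) (hα0 : 0 < α) (hα2 : α < 2)
    (γ : ℝ) (hγ : (2 + α) / (2 - α) ≤ γ) :
    ∃ c : ℝ, 0 < c ∧ ∀ y : EN N, 0 < ‖y‖ → ‖y‖ < 1 →
      c * (1 - ‖y‖)⁻¹ ≤ greenB N α 0 y * delta1 y ^ (γ * (α / 2 - 1)) := by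
  have hNr : (3:ℝ) ≤ N := by exact_mod_cast hN
  have hk : 0 < greenCoeff N α := by
    unfold greenCoeff
    have h1 : 0 < Real.Gamma ((N:ℝ) / 2) := Real.Gamma_pos_of_pos (by linarith)
    have h2 : 0 < Real.Gamma (α / 2) := Real.Gamma_pos_of_pos (by linarith)
    have := Real.pi_pos
    positivity
  refine ⟨greenCoeff N α * ((2:ℝ) ^ (-(N : ℝ) / 2) * (1 / (α / 2))), by positivity, ?_⟩
  intro y hy0 hy1
  have hd : 0 < 1 - ‖y‖ := by linarith
  have hg : greenCoeff N α * ((2:ℝ) ^ (-(N : ℝ) / 2) * ((1 - ‖y‖) ^ (α / 2) / (α / 2))) ≤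
      greenB N α 0 y := by
    have hT : 1 - ‖y‖ ≤ (1 - ‖(0 : EN N)‖ ^ 2) * (1 - ‖y‖ ^ 2) / ‖0 - y‖ ^ 2 := by
      rw [zero_sub, norm_neg, norm_zero, le_div_iff₀ (by positivity)]
      have : ‖y‖ ^ 2 ≤ 1 := by nlinarith
      nlinarith
    have hin := green_inner_aux N α hα0 (1 - ‖y‖) _ hd (by linarith) hT
    have hp : 1 ≤ ‖0 - y‖ ^ (α - (N : ℝ)) := by
      rw [zero_sub, norm_neg]
      exact Real.one_le_rpow_of_pos_of_le_one_of_nonpos hy0 hy1.le (by linarith)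
    have hpos : 0 ≤ (2:ℝ) ^ (-(N : ℝ) / 2) * ((1 - ‖y‖) ^ (α / 2) / (α / 2)) := by positivity
    unfold greenB
    rw [if_pos ⟨by simp, hy1⟩, mul_assoc]
    refine mul_le_mul_of_nonneg_left ?_ hk.le
    calc _ ≤ _ := hin
      _ ≤ _ := le_mul_of_one_le_left (hpos.trans hin) hp
  have hde : (1 - ‖y‖) ^ (-1 - α / 2) ≤ delta1 y ^ (γ * (α / 2 - 1)) := by
    unfold delta1
    rw [if_pos hy1]
    refine Real.rpow_le_rpow_of_exponent_ge hd (by linarith) ?_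
    rw [div_le_iff₀ (by linarith)] at hγ
    linarith
  calc _ = greenCoeff N α * ((2:ℝ) ^ (-(N : ℝ) / 2) * ((1 - ‖y‖) ^ (α / 2) / (α / 2))) *
        (1 - ‖y‖) ^ (-1 - α / 2) := by
        have : (1 - ‖y‖)⁻¹ = (1 - ‖y‖) ^ (α / 2) * (1 - ‖y‖) ^ (-1 - α / 2) := by
          rw [← Real.rpow_add hd, ← Real.rpow_neg_one]
          congr 1
          ring
        rw [this]
        ring
    _ ≤ _ := mul_le_mul hg hde (by positivity) (le_trans (by positivity) hg)

/-- Truncated open cone around the direction `z`. -/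
def coneAux {N : ℕ} (z : EN N) (ρ : ℝ) : Set (EN N) :=
  {y | ‖y‖ < 1 ∧ ‖y - ‖y‖ • z‖ < ρ * ‖y‖}

lemma coneAux_isOpen {N : ℕ} (z : EN N) (ρ : ℝ) : IsOpen (coneAux z ρ) := by
  unfold coneAux
  have h1 : IsOpen {y : EN N | ‖y‖ < 1} := isOpen_lt (by fun_prop) (by fun_prop)
  have h2 : IsOpen {y : EN N | ‖y - ‖y‖ • z‖ < ρ * ‖y‖} := isOpen_lt (by fun_prop) (by fun_prop)
  exact h1.inter h2

open scoped Pointwise in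
lemma coneAux_inter {N : ℕ} (z : EN N) (ρ : ℝ) (s : ℝ) (hs0 : 0 < s) (hs1 : s < 1) :
    coneAux z ρ ∩ Metric.ball 0 s = s • coneAux z ρ := by
  ext y
  rw [Set.mem_smul_set_iff_inv_smul_mem₀ hs0.ne']
  have e : s⁻¹ • y - ‖s⁻¹ • y‖ • z = s⁻¹ • (y - ‖y‖ • z) := by
    rw [norm_smul, Real.norm_of_nonneg (by positivity), smul_sub, smul_smul]
  simp only [coneAux, Set.mem_inter_iff, Set.mem_ofPred_eq, mem_ball_zero_iff, e]
  rw [norm_smul, norm_smul, norm_inv, Real.norm_of_nonneg hs0.le]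
  have h1 : s⁻¹ * ‖y‖ < 1 ↔ ‖y‖ < s := by
    rw [inv_mul_lt_iff₀ hs0, mul_one]
  have h2 : s⁻¹ * ‖y - ‖y‖ • z‖ < ρ * (s⁻¹ * ‖y‖) ↔ ‖y - ‖y‖ • z‖ < ρ * ‖y‖ := by
    rw [mul_left_comm]
    exact mul_lt_mul_iff_right₀ (by positivity)
  rw [h1, h2]
  constructor
  · rintro ⟨⟨_, h⟩, h'⟩
    exact ⟨h', h⟩
  · rintro ⟨h', h⟩
    exact ⟨⟨h'.trans hs1, h⟩, h'⟩

lemma coneAux_finite {N : ℕ} (z : EN N) (ρ : ℝ) : volume (coneAux z ρ) ≠ ⊤ := by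
  refine ne_top_of_le_ne_top (measure_ball_lt_top (μ := volume) (x := (0 : EN N)) (r := 1)).ne
    (measure_mono ?_)
  intro y hy
  exact mem_ball_zero_iff.2 hy.1

lemma coneAux_pos {N : ℕ} (z : EN N) (hz : ‖z‖ = 1) (ρ : ℝ) (hρ : 0 < ρ) :
    0 < volume (coneAux z ρ) := by
  refine (coneAux_isOpen z ρ).measure_pos _ ⟨(1/2 : ℝ) • z, ?_⟩
  have h : ‖(1/2 : ℝ) • z‖ = 1/2 := by
    rw [norm_smul, hz]
    norm_num
  refine ⟨by rw [h]; norm_num, ?_⟩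
  rw [h, sub_self, norm_zero]
  positivity

lemma coneAux_diff {N : ℕ} (z : EN N) (ρ : ℝ) (t : ℝ) (ht0 : 0 < t) (ht1 : t < 1) :
    volume (coneAux z ρ \ Metric.ball 0 (1 - t)) =
      ENNReal.ofReal (1 - (1 - t) ^ N) * volume (coneAux z ρ) := by
  rw [← Set.sdiff_self_inter, measure_sdiff Set.inter_subset_left
    ((coneAux_isOpen z ρ).inter isOpen_ball).measurableSet.nullMeasurableSet
    (ne_top_of_le_ne_top (coneAux_finite z ρ) (measure_mono Set.inter_subset_left)),
    coneAux_inter z ρ (1 - t) (by linarith) (by linarith), Measure.addHaar_smul,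
    finrank_euclideanSpace_fin, abs_of_nonneg (pow_nonneg (by linarith) _),
    ENNReal.ofReal_sub _ (pow_nonneg (by linarith) _), ENNReal.sub_mul, ENNReal.ofReal_one, one_mul]
  intro _ _
  exact coneAux_finite z ρ

/-- divergence of `∫_{B ∩ B(z,r)} G_B^α(0,y) δ(y)^{γ(α/2-1)} dy` when
`γ ≥ (2+α)/(2-α)`. -/
theorem statement_19 (N : ℕ) (hN : 3 ≤ N) (α : ℝ) (hα0 : 0 < α) (hα2 : α < 2)
    (γ : ℝ) (hγ : (2 + α) / (2 - α) ≤ γ)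
    (z : EN N) (hz : ‖z‖ = 1) (r : ℝ) (hr : 0 < r) :
    ∫⁻ y in Metric.ball (0 : EN N) 1 ∩ Metric.ball z r,
      ENNReal.ofReal (greenB N α 0 y * delta1 y ^ (γ * (α / 2 - 1))) = ⊤ := by
  obtain ⟨c, hc, hlow⟩ := green_lower_aux N hN α hα0 hα2 γ hγ
  by_contra hfin
  set f : EN N → ENNReal :=
    fun y => ENNReal.ofReal (greenB N α 0 y * delta1 y ^ (γ * (α / 2 - 1))) with hf
  set E : Set (EN N) := Metric.ball (0 : EN N) 1 ∩ Metric.ball z r with hE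
  set C := coneAux z (r / 2) with hC
  have hCpos : 0 < volume C := coneAux_pos z hz _ (by positivity)
  have hCfin : volume C ≠ ⊤ := coneAux_finite z _
  have hsmall : ∀ᶠ t in 𝓝[>] (0:ℝ), 0 < t ∧ t < 1 ∧ t < r / 2 := by
    filter_upwards [Ioo_mem_nhdsGT (show (0:ℝ) < min 1 (r / 2) by positivity)] with t ht
    exact ⟨ht.1, ht.2.trans_le (min_le_left _ _), ht.2.trans_le (min_le_right _ _)⟩
  have hsub : ∀ t : ℝ, t < r / 2 → C \ Metric.ball 0 (1 - t) ⊆ E := by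
    intro t ht y hy
    obtain ⟨⟨hy1, hy2⟩, hy3⟩ := hy
    rw [mem_ball_zero_iff, not_lt] at hy3
    refine ⟨mem_ball_zero_iff.2 hy1, ?_⟩
    rw [Metric.mem_ball, dist_eq_norm]
    have e : y - z = (y - ‖y‖ • z) + (‖y‖ - 1) • z := by
      rw [sub_smul, one_smul]
      abel
    have h1 : ‖(‖y‖ - 1) • z‖ = 1 - ‖y‖ := by
      rw [norm_smul, hz, mul_one, Real.norm_eq_abs, abs_of_neg (by linarith)]
      ring
    have h2 := norm_add_le (y - ‖y‖ • z) ((‖y‖ - 1) • z)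
    rw [← e, h1] at h2
    have h3 : r / 2 * ‖y‖ ≤ r / 2 := mul_le_of_le_one_right (by positivity) hy1.le
    linarith
  have hlim0 : Tendsto (fun t : ℝ => ENNReal.ofReal (1 - (1 - t) ^ N) * volume C)
      (𝓝[>] (0:ℝ)) (𝓝 0) := by
    have h1 : Tendsto (fun t : ℝ => 1 - (1 - t) ^ N) (𝓝[>] (0:ℝ)) (𝓝 0) := by
      have : Continuous (fun t : ℝ => 1 - (1 - t) ^ N) := by fun_prop
      have h := this.tendsto 0
      simp only [sub_zero, one_pow, sub_self] at h
      exact h.mono_left nhdsWithin_le_nhds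
    have h2 := ENNReal.Tendsto.mul_const (b := volume C) (ENNReal.tendsto_ofReal h1)
      (Or.inr hCfin)
    simpa using h2
  have hmeas : Tendsto ((volume.restrict E) ∘ fun t : ℝ => C \ Metric.ball 0 (1 - t))
      (𝓝[>] (0:ℝ)) (𝓝 0) := by
    refine tendsto_of_tendsto_of_tendsto_of_le_of_le' tendsto_const_nhds hlim0
      (Eventually.of_forall fun _ => zero_le) ?_
    filter_upwards [hsmall] with t ht
    rw [← coneAux_diff z (r / 2) t ht.1 ht.2.1]
    exact Measure.restrict_apply_le _ _
  have hten := tendsto_setLIntegral_zero hfin hmeas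
  have hge : ∀ᶠ t in 𝓝[>] (0:ℝ), ENNReal.ofReal c * volume C ≤
      ∫⁻ y in C \ Metric.ball 0 (1 - t), f y ∂(volume.restrict E) := by
    filter_upwards [hsmall] with t ht
    obtain ⟨ht0, ht1, htr⟩ := ht
    have hm : MeasurableSet (C \ Metric.ball (0 : EN N) (1 - t)) :=
      (coneAux_isOpen z _).measurableSet.diff isOpen_ball.measurableSet
    rw [Measure.restrict_restrict hm, Set.inter_eq_left.2 (hsub t htr)]
    calc ENNReal.ofReal c * volume C
        ≤ ENNReal.ofReal (c * t⁻¹) * volume (C \ Metric.ball (0 : EN N) (1 - t)) := by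
          rw [coneAux_diff z (r / 2) t ht0 ht1, ← mul_assoc, ← ENNReal.ofReal_mul (by positivity)]
          gcongr
          have h1 : (1 - t) ^ N ≤ 1 - t :=
            pow_le_of_le_one (by linarith) (by linarith) (by lia)
          calc c = c * t⁻¹ * t := by field_simp
            _ ≤ _ := mul_le_mul_of_nonneg_left (by linarith) (by positivity)
      _ = ∫⁻ y in C \ Metric.ball (0 : EN N) (1 - t), ENNReal.ofReal (c * t⁻¹) := by
          rw [setLIntegral_const]
      _ ≤ _ := by
          refine setLIntegral_mono' hm ?_
          intro y hy
          obtain ⟨⟨hy1, hy2⟩, hy3⟩ := hy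
          rw [mem_ball_zero_iff, not_lt] at hy3
          refine ENNReal.ofReal_le_ofReal (le_trans ?_ (hlow y (by linarith) hy1))
          refine mul_le_mul_of_nonneg_left ?_ hc.le
          exact inv_anti₀ (by linarith) (by linarith)
  have := ge_of_tendsto hten hge
  have hpos : 0 < ENNReal.ofReal c * volume C :=
    ENNReal.mul_pos (ENNReal.ofReal_pos.2 hc).ne' hCpos.ne'
  exact absurd this (not_le.2 hpos)

end
end
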